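/- Let 2/3 < α < 1 and let θ be the global solution of (QG)_α given by Theorem 1.1 with ‖θ⁰‖_{X^{1−2α}} < 1/4. Then lim_{t→∞} ‖θ(t)‖_{X^{1−2α}} = 0. -/

import Mathlib

open MeasureTheory Real Filter Set

noncomputable section

/-- Frequency space `ℝ²`. We work on the Fourier side: `F` denotes `f̂`. -/
abbrev E2 := EuclideanSpace ℝ (Fin 2)

/-- The `X^σ` norm: `‖f‖_{X^σ} = ∫ |ξ|^σ |f̂(ξ)| dξ`. -/
noncomputable def Xnorm (σ : ℝ) (F : E2 → ℂ) : ℝ := ∫ ξ : E2, ‖ξ‖ ^ σ * ‖F ξ‖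

/-- Membership in `X^σ`: `ξ ↦ |ξ|^σ f̂(ξ)` is integrable. -/
def MemX (σ : ℝ) (F : E2 → ℂ) : Prop :=
  Integrable (fun ξ : E2 => ‖ξ‖ ^ σ * ‖F ξ‖)

/-- Fourier transform of the velocity `u = R^⊥θ = (-R₂θ, R₁θ)`:
`û₀(η) = (η₁/|η|)θ̂(η)`, `û₁(η) = -(η₀/|η|)θ̂(η)`. -/
noncomputable def uhat (Θ : E2 → ℂ) (j : Fin 2) (η : E2) : ℂ :=
  if j = 0 then ((η 1 / ‖η‖ : ℝ) : ℂ) * Θ η else ((-(η 0) / ‖η‖ : ℝ) : ℂ) * Θ η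

/-- Fourier transform of the nonlinearity `∇·(uθ)`:
`B̂(ξ) = i ∑ⱼ ξⱼ (ûⱼ * θ̂)(ξ)`. -/
noncomputable def Bhat (Θ : E2 → ℂ) (ξ : E2) : ℂ :=
  Complex.I * ∑ j : Fin 2, (ξ j : ℂ) * ∫ η : E2, uhat Θ j (ξ - η) * Θ η

/-- The point `(⌊(n+1)t⌋ + 1)/(n+1)`, which lies strictly to the right of `t ≥ 0`, tends to `t`. -/
lemma tendsto_floor_succ_div_nhdsGT {t : ℝ} (ht : 0 ≤ t) :
    Tendsto (fun n : ℕ => ((⌊((n : ℝ) + 1) * t⌋₊ : ℝ) + 1) / ((n : ℝ) + 1)) atTop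
      (nhdsWithin t (Ioi t)) := by
  have hpos : ∀ n : ℕ, (0 : ℝ) < (n : ℝ) + 1 := fun n => by positivity
  have hgt : ∀ n : ℕ, t < ((⌊((n : ℝ) + 1) * t⌋₊ : ℝ) + 1) / ((n : ℝ) + 1) := fun n => by
    rw [lt_div_iff₀ (hpos n), mul_comm]
    exact Nat.lt_floor_add_one _
  refine tendsto_nhdsWithin_iff.2 ⟨?_, Eventually.of_forall hgt⟩
  have h1 : Tendsto (fun n : ℕ => t + 1 / ((n : ℝ) + 1)) atTop (nhds t) := by
    simpa using tendsto_const_nhds.add (tendsto_one_div_add_atTop_nhds_zero_nat (𝕜 := ℝ))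
  refine tendsto_of_tendsto_of_tendsto_of_le_of_le tendsto_const_nhds h1
    (fun n => (hgt n).le) (fun n => ?_)
  have := Nat.floor_le (mul_nonneg (hpos n).le ht)
  simp only
  have hinv : 1 / ((n : ℝ) + 1) * ((n : ℝ) + 1) = 1 := by have := (hpos n).ne'; field_simp
  rw [div_le_iff₀ (hpos n)]
  linarith [add_mul t (1 / ((n : ℝ) + 1)) ((n : ℝ) + 1)]

/-- A family of a.e. measurable functions whose trajectories have at most one time at which they
are not right-continuous has a jointly measurable modification. -/
lemma exists_measurable_modification {X : Type*} [MeasurableSpace X] {μ : Measure X} [SFinite μ]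
    {F : ℝ → X → ENNReal} (hF : ∀ t, 0 ≤ t → AEMeasurable (F t) μ)
    (hone : ∀ x s t, 0 ≤ s → 0 ≤ t →
      ¬ ContinuousWithinAt (fun r => F r x) (Ioi s) s →
      ¬ ContinuousWithinAt (fun r => F r x) (Ioi t) t → s = t) :
    ∃ a : ℝ × X → ENNReal, Measurable a ∧
      ∀ᵐ t ∂(volume.restrict (Ioi (0 : ℝ))), F t =ᵐ[μ] fun x => a (t, x) := by
  have hgrid : ∀ n k : ℕ, ∃ g : X → ENNReal, Measurable g ∧
      F (((k : ℝ) + 1) / ((n : ℝ) + 1)) =ᵐ[μ] g :=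
    fun n k => hF _ (by positivity)
  choose g hgm hg using hgrid
  let G : ℕ → ℝ × X → ENNReal := fun n p => g n ⌊((n : ℝ) + 1) * p.1⌋₊ p.2
  have hGm : ∀ n, Measurable (G n) := fun n => by
    have h1 : Measurable fun q : ℕ × X => g n q.1 q.2 :=
      measurable_from_prod_countable_right fun k => hgm n k
    exact h1.comp ((Nat.measurable_floor.comp (measurable_const.mul measurable_fst)).prodMk
      measurable_snd)
  obtain ⟨a, ha, ham⟩ : ∃ a : ℝ × X → ENNReal,
      (∀ p, a p = limsup (fun n => G n p) atTop) ∧ Measurable a :=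
    ⟨_, fun _ => rfl, Measurable.limsup hGm⟩
  have hgood : ∀ᵐ x ∂μ, ∀ t, 0 ≤ t → ContinuousWithinAt (fun r => F r x) (Ioi t) t →
      F t x = a (t, x) := by
    have hae : ∀ᵐ x ∂μ, ∀ n k : ℕ,
        F (((k : ℝ) + 1) / ((n : ℝ) + 1)) x = g n k x :=
      ae_all_iff.2 fun n => ae_all_iff.2 fun k => hg n k
    filter_upwards [hae] with x hx t ht hc
    have := hc.tendsto.comp (tendsto_floor_succ_div_nhdsGT ht)
    rw [ha]
    refine (Tendsto.limsup_eq ?_).symm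
    refine this.congr fun n => ?_
    exact hx n _
  refine ⟨a, ham, ?_⟩
  let A : Ici (0 : ℝ) → Set X := fun t => {x | F t x ≠ a (t, x)} 
  have hAm : ∀ t, NullMeasurableSet (A t) μ := fun t =>
    (nullMeasurableSet_eq_fun (hF t t.2)
      (ham.comp (measurable_const.prodMk measurable_id)).aemeasurable).compl
  have hAd : Pairwise (Function.onFun (AEDisjoint μ) A) := fun s t hst => by
    refine measure_mono_null (fun x hx => ?_) (mem_ae_iff.1 hgood)
    rintro (h : ∀ t, 0 ≤ t → ContinuousWithinAt (fun r => F r x) (Ioi t) t → F t x = a (t, x))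
    exact hst (Subtype.ext (hone x s t s.2 t.2 (fun hc => hx.1 (h s s.2 hc))
      (fun hc => hx.2 (h t t.2 hc))))
  have hcount := (Measure.countable_meas_pos_of_disjoint_iUnion₀ hAm hAd).image Subtype.val
  filter_upwards [ae_restrict_mem measurableSet_Ioi, hcount.ae_notMem _] with t ht hnt
  by_contra hne
  refine hnt ⟨⟨t, Ioi_subset_Ici_self ht⟩, ?_, rfl⟩
  exact pos_iff_ne_zero.2 fun h0 => hne h0

/-- With the junk value `0` for non-integrable functions, a primitive of an arbitrary function
fails to be right-continuous at most once. -/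
lemma eq_of_not_continuousWithinAt_primitive {g : ℝ → ℂ} {s t : ℝ} (hs : 0 ≤ s) (ht : 0 ≤ t)
    (hcs : ¬ ContinuousWithinAt (fun r => ∫ x in (0:ℝ)..r, g x) (Ioi s) s)
    (hct : ¬ ContinuousWithinAt (fun r => ∫ x in (0:ℝ)..r, g x) (Ioi t) t) : s = t := by
  have hright : ∀ r, 0 ≤ r → ¬ ContinuousWithinAt (fun r => ∫ x in (0:ℝ)..r, g x) (Ioi r) r →
      IntervalIntegrable g volume 0 r ∧ ∀ r', r < r' → ¬ IntervalIntegrable g volume 0 r' := by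
    intro r hr hc
    have h2 : ∀ r', r < r' → ¬ IntervalIntegrable g volume 0 r' := by
      intro r' hr' hi
      refine hc ?_
      have h := intervalIntegral.continuousOn_primitive_interval' hi left_mem_uIcc
      rw [uIcc_of_le (hr.trans hr'.le)] at h
      refine (h r ⟨hr, hr'.le⟩).mono_of_mem_nhdsWithin ?_
      exact mem_of_superset (Ioo_mem_nhdsGT hr') fun x hx => ⟨hr.trans hx.1.le, hx.2.le⟩
    refine ⟨by_contra fun hi => hc ?_, h2⟩
    have h0 : (fun r => ∫ x in (0:ℝ)..r, g x) r = 0 := intervalIntegral.integral_undef hi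
    refine (continuousWithinAt_const (b := (0 : ℂ))).congr (fun x hx => ?_) h0
    exact intervalIntegral.integral_undef (h2 x hx)
  obtain ⟨hs1, hs2⟩ := hright s hs hcs
  obtain ⟨ht1, ht2⟩ := hright t ht hct
  rcases lt_trichotomy s t with h | h | h
  · exact absurd ht1 (hs2 t h)
  · exact h
  · exact absurd hs1 (ht2 s h)

/-- The multiplier inequality behind the bilinear estimate. -/
lemma norm_add_rpow_le {α : ℝ} (hα1 : 1 / 2 < α) (hα2 : α < 1) {a b : E2} (ha : a ≠ 0)
    (hb : b ≠ 0) :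
    ‖a + b‖ ^ (2 - 2*α) ≤ 2 * (‖a‖ ^ (1 - 2*α) * ‖b‖ + ‖a‖ * ‖b‖ ^ (1 - 2*α)) := by
  have key : ∀ a b : E2, a ≠ 0 → b ≠ 0 → ‖a‖ ≤ ‖b‖ →
      ‖a + b‖ ^ (2 - 2*α) ≤ 2 * (‖a‖ ^ (1 - 2*α) * ‖b‖) := by
    intro a b ha hb hab
    have ha' := norm_pos_iff.2 ha
    have hb' := norm_pos_iff.2 hb
    calc ‖a + b‖ ^ (2 - 2*α) ≤ (2 * ‖b‖) ^ (2 - 2*α) := by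
          refine Real.rpow_le_rpow (norm_nonneg _) ?_ (by linarith)
          linarith [norm_add_le a b]
      _ = 2 ^ (2 - 2*α) * ‖b‖ ^ (2 - 2*α) := Real.mul_rpow (by norm_num) hb'.le
      _ ≤ 2 ^ (1 : ℝ) * (‖a‖ ^ (1 - 2*α) * ‖b‖) := by
          refine mul_le_mul (Real.rpow_le_rpow_of_exponent_le (by norm_num) (by linarith)) ?_
            (by positivity) (by positivity)
          · rw [show 2 - 2*α = (1 - 2*α) + 1 by ring, Real.rpow_add_one hb'.ne']
            exact mul_le_mul_of_nonneg_right
              (Real.rpow_le_rpow_of_nonpos ha' hab (by linarith)) hb'.le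
      _ = 2 * (‖a‖ ^ (1 - 2*α) * ‖b‖) := by rw [Real.rpow_one]
  rcases le_total ‖a‖ ‖b‖ with h | h
  · refine (key a b ha hb h).trans ?_
    gcongr
    exact le_add_of_nonneg_right (by positivity)
  · rw [add_comm a b]
    refine (key b a hb ha h).trans ?_
    rw [mul_comm (‖b‖ ^ _)]
    gcongr
    exact le_add_of_nonneg_left (by positivity)

lemma ae_ne_zero : ∀ᵐ ξ : E2, ξ ≠ 0 := by
  simp [ae_iff]

/-- The bilinear estimate `∫ |ξ|^{2-2α} (f * f) ≤ 4 ‖f‖_{X^{1-2α}} ‖f‖_{X¹}`. -/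
lemma lintegral_rpow_mul_conv_le {α : ℝ} (hα1 : 1 / 2 < α) (hα2 : α < 1) {f : E2 → ENNReal}
    (hf : Measurable f) :
    ∫⁻ ξ, ENNReal.ofReal (‖ξ‖ ^ (2 - 2*α)) * ∫⁻ η, f (ξ - η) * f η ≤
      4 * ((∫⁻ ξ, ENNReal.ofReal (‖ξ‖ ^ (1 - 2*α)) * f ξ) * ∫⁻ ξ, ENNReal.ofReal ‖ξ‖ * f ξ) := by
  set N := ∫⁻ ξ, ENNReal.ofReal (‖ξ‖ ^ (1 - 2*α)) * f ξ
  set M := ∫⁻ ξ, ENNReal.ofReal ‖ξ‖ * f ξ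
  have hfN : Measurable fun ξ => ENNReal.ofReal (‖ξ‖ ^ (1 - 2*α)) * f ξ := by fun_prop
  have hfM : Measurable fun ξ => ENNReal.ofReal ‖ξ‖ * f ξ := by fun_prop
  calc ∫⁻ ξ, ENNReal.ofReal (‖ξ‖ ^ (2 - 2*α)) * ∫⁻ η, f (ξ - η) * f η
      = ∫⁻ ξ, ∫⁻ η, ENNReal.ofReal (‖ξ‖ ^ (2 - 2*α)) * (f (ξ - η) * f η) := by
        refine lintegral_congr fun ξ => (lintegral_const_mul _ (by fun_prop)).symm
    _ = ∫⁻ η, ∫⁻ ξ, ENNReal.ofReal (‖ξ‖ ^ (2 - 2*α)) * (f (ξ - η) * f η) :=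
        lintegral_lintegral_swap (by fun_prop)
    _ = ∫⁻ η, ∫⁻ ξ, ENNReal.ofReal (‖ξ + η‖ ^ (2 - 2*α)) * (f ξ * f η) := by
        refine lintegral_congr fun η => ?_
        rw [← lintegral_add_right_eq_self _ η]
        simp
    _ ≤ ∫⁻ η, ∫⁻ ξ, 2 * ((ENNReal.ofReal (‖ξ‖ ^ (1 - 2*α)) * f ξ) * (ENNReal.ofReal ‖η‖ * f η) +
          (ENNReal.ofReal ‖ξ‖ * f ξ) * (ENNReal.ofReal (‖η‖ ^ (1 - 2*α)) * f η)) := by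
        refine lintegral_mono_ae ?_
        filter_upwards [ae_ne_zero] with η hη
        refine lintegral_mono_ae ?_
        filter_upwards [ae_ne_zero] with ξ hξ
        have h := ENNReal.ofReal_le_ofReal (norm_add_rpow_le hα1 hα2 hξ hη)
        rw [ENNReal.ofReal_mul (by norm_num), ENNReal.ofReal_add (by positivity) (by positivity),
          ENNReal.ofReal_mul (by positivity), ENNReal.ofReal_mul (by positivity),
          ENNReal.ofReal_ofNat] at h
        calc _ ≤ _ := mul_le_mul_left h _
          _ = _ := by ring
    _ = ∫⁻ η, 2 * (N * (ENNReal.ofReal ‖η‖ * f η) +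
          M * (ENNReal.ofReal (‖η‖ ^ (1 - 2*α)) * f η)) := by
        refine lintegral_congr fun η => ?_
        rw [lintegral_const_mul _ (by fun_prop), lintegral_add_left (by fun_prop),
          lintegral_mul_const _ hfN, lintegral_mul_const _ hfM]
    _ = 4 * (N * M) := by
        rw [lintegral_const_mul _ (by fun_prop), lintegral_add_left (by fun_prop),
          lintegral_const_mul _ hfN, lintegral_const_mul _ hfM]
        ring

lemma norm_uhat_le (Θ : E2 → ℂ) (j : Fin 2) (η : E2) : ‖uhat Θ j η‖ ≤ ‖Θ η‖ := by
  have h : ∀ i, |η i / ‖η‖| ≤ 1 := fun i => by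
    rw [abs_div, abs_norm]
    exact div_le_one_of_le₀ (PiLp.norm_apply_le η i) (norm_nonneg _)
  have h' : |-(η 0) / ‖η‖| ≤ 1 := by rw [neg_div, abs_neg]; exact h 0
  unfold uhat
  split_ifs <;> rw [norm_mul, Complex.norm_real, Real.norm_eq_abs] <;>
    refine mul_le_of_le_one_left (norm_nonneg _) ?_
  · exact h 1
  · exact h'

lemma enorm_Bhat_le {Θ : E2 → ℂ} {f : E2 → ENNReal} (h : (fun η => ‖Θ η‖ₑ) =ᵐ[volume] f)
    (ξ : E2) : ‖Bhat Θ ξ‖ₑ ≤ 2 * (ENNReal.ofReal ‖ξ‖ * ∫⁻ η, f (ξ - η) * f η) := by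
  have hj : ∀ j : Fin 2, ‖(ξ j : ℂ) * ∫ η : E2, uhat Θ j (ξ - η) * Θ η‖ₑ ≤
      ENNReal.ofReal ‖ξ‖ * ∫⁻ η, f (ξ - η) * f η := by
    intro j
    rw [enorm_mul]
    gcongr
    · rw [← ofReal_norm, Complex.norm_real]
      exact ENNReal.ofReal_le_ofReal (PiLp.norm_apply_le ξ j)
    · refine (enorm_integral_le_lintegral_enorm _).trans (lintegral_mono_ae ?_)
      filter_upwards [h, (quasiMeasurePreserving_sub_left_of_right_invariant volume ξ).ae h]
        with η h1 h2
      rw [enorm_mul, ← h1, ← h2]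
      gcongr
      exact enorm_le_iff_norm_le.2 (norm_uhat_le _ _ _)
  unfold Bhat
  have hI : ‖Complex.I‖ₑ = 1 := by rw [← ofReal_norm, Complex.norm_I, ENNReal.ofReal_one]
  rw [enorm_mul, Fin.sum_univ_two, two_mul, hI, one_mul]
  exact (enorm_add_le _ _).trans (add_le_add (hj 0) (hj 1))

lemma MemX.aemeasurable_enorm {σ : ℝ} {F : E2 → ℂ} (h : MemX σ F) :
    AEMeasurable fun ξ => ‖F ξ‖ₑ := by
  have h1 : AEMeasurable fun ξ : E2 => ENNReal.ofReal (‖ξ‖ ^ (-σ) * (‖ξ‖ ^ σ * ‖F ξ‖)) :=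
    (AEMeasurable.mul (by fun_prop) h.aemeasurable).ennreal_ofReal
  refine h1.congr ?_
  filter_upwards [ae_ne_zero] with ξ hξ
  have hξ' := norm_pos_iff.2 hξ
  rw [← mul_assoc, ← Real.rpow_add hξ', neg_add_cancel, Real.rpow_zero, one_mul, ofReal_norm]

lemma MemX.ofReal_Xnorm {σ : ℝ} {F : E2 → ℂ} (h : MemX σ F) :
    ENNReal.ofReal (Xnorm σ F) = ∫⁻ ξ, ENNReal.ofReal (‖ξ‖ ^ σ) * ‖F ξ‖ₑ := by
  unfold Xnorm
  rw [ofReal_integral_eq_lintegral_ofReal h (Eventually.of_forall fun ξ => by positivity)]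
  refine lintegral_congr fun ξ => ?_
  rw [ENNReal.ofReal_mul (by positivity), ofReal_norm]

lemma Xnorm_nonneg (σ : ℝ) (F : E2 → ℂ) : 0 ≤ Xnorm σ F :=
  integral_nonneg fun ξ => by positivity

/-- The moduli `|Θ t ξ|` of a mild solution have a jointly measurable version. -/
lemma exists_measurable_enorm_of_duhamel {α σ : ℝ} {Θ0 : E2 → ℂ} {Θ : ℝ → E2 → ℂ}
    (hmem : ∀ t : ℝ, 0 ≤ t → MemX σ (Θ t))
    (hDuhamel : ∀ t : ℝ, 0 ≤ t → ∀ᵐ ξ : E2, Θ t ξ =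
      ((Real.exp (-t * ‖ξ‖ ^ (2*α)) : ℝ) : ℂ) * Θ0 ξ -
        ∫ s in (0:ℝ)..t, ((Real.exp (-(t - s) * ‖ξ‖ ^ (2*α)) : ℝ) : ℂ) * Bhat (Θ s) ξ) :
    ∃ a : ℝ × E2 → ENNReal, Measurable a ∧ ∀ᵐ t ∂(volume.restrict (Ioi (0 : ℝ))),
      (fun ξ => ‖Θ t ξ‖ₑ) =ᵐ[volume] fun ξ => a (t, ξ) := by
  let J : ℝ → E2 → ℂ := fun t ξ =>
    ∫ s in (0:ℝ)..t, ((Real.exp (s * ‖ξ‖ ^ (2*α)) : ℝ) : ℂ) * Bhat (Θ s) ξ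
  let F : ℝ → E2 → ENNReal := fun t ξ =>
    ‖((Real.exp (-t * ‖ξ‖ ^ (2*α)) : ℝ) : ℂ) * (Θ0 ξ - J t ξ)‖ₑ
  have hFΘ : ∀ t, 0 ≤ t → (fun ξ => ‖Θ t ξ‖ₑ) =ᵐ[volume] F t := by
    intro t ht
    filter_upwards [hDuhamel t ht] with ξ hξ
    rw [hξ]
    simp only [F, J]
    rw [mul_sub, ← intervalIntegral.integral_const_mul]
    congr 3
    funext s
    rw [← mul_assoc, ← Complex.ofReal_mul, ← Real.exp_add]
    congr 4
    ring
  obtain ⟨a, ham, ha⟩ := exists_measurable_modification (μ := volume) (F := F)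
    (fun t ht => (hmem t ht).aemeasurable_enorm.congr (hFΘ t ht))
    (fun ξ s t hs ht hcs hct => by
      have hc : ∀ r, ¬ ContinuousWithinAt (fun r => F r ξ) (Ioi r) r →
          ¬ ContinuousWithinAt (fun r => J r ξ) (Ioi r) r := by
        intro r hr hJ
        refine hr (ContinuousWithinAt.enorm (ContinuousWithinAt.mul ?_
          (continuousWithinAt_const.sub hJ)))
        exact Continuous.continuousWithinAt (by fun_prop)
      exact eq_of_not_continuousWithinAt_primitive hs ht (hc s hcs) (hc t hct))
  refine ⟨a, ham, ?_⟩
  filter_upwards [ha, ae_restrict_mem measurableSet_Ioi] with t h1 h2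
  exact (hFΘ t (le_of_lt h2)).trans h1

/-- The Fourier symbol of the heat semigroup at time `t`, tending to `0` off the zero frequency. -/
lemma tendsto_exp_neg_sub_mul {α : ℝ} {ξ : E2} (hξ : ξ ≠ 0) (s : ℝ) :
    Tendsto (fun t : ℝ => ENNReal.ofReal (Real.exp (-(t - s) * ‖ξ‖ ^ (2*α)))) atTop (nhds 0) := by
  have hξ' : 0 < ‖ξ‖ ^ (2*α) := Real.rpow_pos_of_pos (norm_pos_iff.2 hξ) _
  have h1 : Tendsto (fun t : ℝ => Real.exp (-(t - s) * ‖ξ‖ ^ (2*α))) atTop (nhds 0) := by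
    refine Real.tendsto_exp_atBot.comp (Tendsto.atBot_mul_const hξ' ?_)
    exact tendsto_neg_atTop_atBot.comp (tendsto_atTop_add_const_right _ (-s) tendsto_id)
  simpa using ENNReal.tendsto_ofReal h1

/-- Decay of the linear evolution. -/
lemma tendsto_lintegral_exp_mul {α : ℝ} {g : E2 → ENNReal} (hg : AEMeasurable g)
    (hfin : ∫⁻ ξ, g ξ ≠ ⊤) :
    Tendsto (fun t : ℝ => ∫⁻ ξ, ENNReal.ofReal (Real.exp (-t * ‖ξ‖ ^ (2*α))) * g ξ) atTop
      (nhds 0) := by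
  have h := tendsto_lintegral_filter_of_dominated_convergence' (l := atTop) (f := fun _ => 0)
    (F := fun (t : ℝ) (ξ : E2) => ENNReal.ofReal (Real.exp (-t * ‖ξ‖ ^ (2*α))) * g ξ) g
    (Eventually.of_forall fun t => AEMeasurable.mul (by fun_prop) hg)
    ?_ hfin ?_
  · simpa using h
  · filter_upwards [eventually_ge_atTop 0] with t ht
    refine Eventually.of_forall fun ξ => mul_le_of_le_one_left zero_le ?_
    rw [ENNReal.ofReal_le_one, Real.exp_le_one_iff]
    have : 0 ≤ ‖ξ‖ ^ (2*α) := by positivity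
    nlinarith
  · filter_upwards [ae_ne_zero, ae_lt_top' hg hfin] with ξ hξ hξ'
    simpa using ENNReal.Tendsto.mul_const (tendsto_exp_neg_sub_mul (α := α) hξ 0)
      (Or.inr hξ'.ne)

/-- Decay of the Duhamel term for an integrable source. -/
lemma tendsto_lintegral_duhamel {α : ℝ} {H : ℝ × E2 → ENNReal} (hH : Measurable H)
    (hfin : ∫⁻ p, H p ∂((volume.restrict (Ioi (0 : ℝ))).prod volume) ≠ ⊤) :
    Tendsto (fun t : ℝ => ∫⁻ ξ, ∫⁻ s in Ioc 0 t,
      ENNReal.ofReal (Real.exp (-(t - s) * ‖ξ‖ ^ (2*α))) * H (s, ξ)) atTop (nhds 0) := by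
  let K : ℝ → ℝ × E2 → ENNReal := fun t p => (Iic t ×ˢ univ).indicator
    (fun p => ENNReal.ofReal (Real.exp (-(t - p.1) * ‖p.2‖ ^ (2*α))) * H p) p
  have hK : ∀ t, Measurable (K t) := fun t =>
    Measurable.indicator (by fun_prop) (measurableSet_Iic.prod MeasurableSet.univ)
  have heq : ∀ t, ∫⁻ p, K t p ∂((volume.restrict (Ioi (0 : ℝ))).prod volume) =
      ∫⁻ ξ, ∫⁻ s in Ioc 0 t, ENNReal.ofReal (Real.exp (-(t - s) * ‖ξ‖ ^ (2*α))) * H (s, ξ) := by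
    intro t
    rw [lintegral_prod_symm' _ (hK t)]
    refine lintegral_congr fun ξ => ?_
    rw [← Ioi_inter_Iic, inter_comm, ← Measure.restrict_restrict measurableSet_Iic,
      ← lintegral_indicator measurableSet_Iic]
    refine lintegral_congr fun s => ?_
    by_cases hs : s ≤ t <;> simp [K, indicator, hs]
  simp_rw [← heq]
  have h := tendsto_lintegral_filter_of_dominated_convergence (l := atTop) (f := fun _ => 0)
    (F := K) H (Eventually.of_forall hK) ?_ hfin ?_
  · simpa using h
  · refine Eventually.of_forall fun t => Eventually.of_forall fun p => ?_
    refine indicator_le' (fun p hp => ?_) (fun p hp => zero_le) p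
    refine mul_le_of_le_one_left zero_le ?_
    rw [ENNReal.ofReal_le_one, Real.exp_le_one_iff]
    have h1 : 0 ≤ ‖p.2‖ ^ (2*α) := by positivity
    have h2 : p.1 ≤ t := hp.1
    nlinarith
  · filter_upwards [Measure.quasiMeasurePreserving_snd.ae ae_ne_zero, ae_lt_top hH hfin]
      with p hp hp'
    have h1 := ENNReal.Tendsto.mul_const (tendsto_exp_neg_sub_mul (α := α) hp p.1)
      (Or.inr hp'.ne)
    rw [zero_mul] at h1
    exact tendsto_of_tendsto_of_tendsto_of_le_of_le tendsto_const_nhds h1 (fun _ => zero_le)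
      (fun t => indicator_le_self' (fun _ _ => zero_le) p)

/-- Main theorem: for `2/3 < α < 1`, the global solution of `(QG)_α` given by
Theorem 1.1 (small data `‖θ⁰‖_{X^{1-2α}} < 1/4`, `θ ∈ C([0,∞), X^{1-2α})`,
`∫₀^∞ ‖θ(s)‖_{X¹} ds < ∞`) satisfies `lim_{t→∞} ‖θ(t)‖_{X^{1-2α}} = 0`. -/
theorem stmt_13 (α : ℝ) (hα1 : 2/3 < α) (hα2 : α < 1)
    (Θ0 : E2 → ℂ) (hΘ0 : MemX (1 - 2*α) Θ0) (hsmall : Xnorm (1 - 2*α) Θ0 < 1/4)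
    (Θ : ℝ → E2 → ℂ)
    (hmem : ∀ t : ℝ, 0 ≤ t → MemX (1 - 2*α) (Θ t))
    (hcont : Continuous fun t => Xnorm (1 - 2*α) (Θ t))
    (hmem1 : ∀ t : ℝ, 0 < t → MemX 1 (Θ t))
    (hint : IntegrableOn (fun s => Xnorm 1 (Θ s)) (Ici 0))
    (hapriori : ∀ t : ℝ, 0 ≤ t →
      Xnorm (1 - 2*α) (Θ t) +
          ((1 - 4 * Xnorm (1 - 2*α) Θ0) / 2) * ∫ s in (0:ℝ)..t, Xnorm 1 (Θ s) ≤
        Xnorm (1 - 2*α) Θ0)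
    (hDuhamel : ∀ t : ℝ, 0 ≤ t → ∀ᵐ ξ : E2, Θ t ξ =
      ((Real.exp (-t * ‖ξ‖ ^ (2*α)) : ℝ) : ℂ) * Θ0 ξ -
        ∫ s in (0:ℝ)..t, ((Real.exp (-(t - s) * ‖ξ‖ ^ (2*α)) : ℝ) : ℂ) * Bhat (Θ s) ξ) :
    Tendsto (fun t => Xnorm (1 - 2*α) (Θ t)) atTop (nhds 0) := by
  have hx0 : ∀ t, 0 ≤ t → Xnorm (1 - 2*α) (Θ t) ≤ 1 := fun t ht => by
    have h1 := hapriori t ht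
    have h2 : 0 ≤ ∫ s in (0:ℝ)..t, Xnorm 1 (Θ s) :=
      intervalIntegral.integral_nonneg ht fun s _ => Xnorm_nonneg _ _
    have h3 : 0 ≤ ((1 - 4 * Xnorm (1 - 2*α) Θ0) / 2) * ∫ s in (0:ℝ)..t, Xnorm 1 (Θ s) :=
      mul_nonneg (by linarith) h2
    linarith
  obtain ⟨a, ham, ha⟩ := exists_measurable_enorm_of_duhamel hmem hDuhamel
  let C : ℝ × E2 → ENNReal := fun p => ∫⁻ η, a (p.1, p.2 - η) * a (p.1, η)
  have hC : Measurable C := by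
    have h : Measurable fun q : (ℝ × E2) × E2 =>
        a (q.1.1, q.1.2 - q.2) * a (q.1.1, q.2) := by fun_prop
    exact h.lintegral_prod_right'
  let H : ℝ × E2 → ENNReal := fun p =>
    ENNReal.ofReal (‖p.2‖ ^ (1 - 2*α)) * (2 * (ENNReal.ofReal ‖p.2‖ * C p))
  have hH : Measurable H := by fun_prop
  have hHfin : ∫⁻ p, H p ∂((volume.restrict (Ioi (0 : ℝ))).prod volume) ≠ ⊤ := by
    rw [lintegral_prod _ hH.aemeasurable]
    have hint' : ∫⁻ s in Ioi (0 : ℝ), ENNReal.ofReal (Xnorm 1 (Θ s)) < ⊤ :=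
      Integrable.lintegral_lt_top (hint.mono_set Ioi_subset_Ici_self)
    refine ne_top_of_le_ne_top (ENNReal.mul_ne_top (by simp : (8 : ENNReal) ≠ ⊤) hint'.ne) ?_
    rw [← lintegral_const_mul' _ _ (by simp)]
    refine lintegral_mono_ae ?_
    filter_upwards [ha, ae_restrict_mem measurableSet_Ioi] with s hs hs0
    have hs0' : (0 : ℝ) ≤ s := le_of_lt hs0
    have hN : ∫⁻ ξ, ENNReal.ofReal (‖ξ‖ ^ (1 - 2*α)) * a (s, ξ) ≤ 1 := by
      calc _ = ENNReal.ofReal (Xnorm (1 - 2*α) (Θ s)) := by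
            rw [(hmem s hs0').ofReal_Xnorm]
            refine lintegral_congr_ae ?_
            filter_upwards [hs] with ξ hξ
            rw [hξ]
        _ ≤ 1 := ENNReal.ofReal_le_one.2 (hx0 s hs0')
    have hM : ∫⁻ ξ, ENNReal.ofReal ‖ξ‖ * a (s, ξ) = ENNReal.ofReal (Xnorm 1 (Θ s)) := by
      rw [(hmem1 s hs0).ofReal_Xnorm]
      refine lintegral_congr_ae ?_
      filter_upwards [hs] with ξ hξ
      rw [hξ, Real.rpow_one]
    calc ∫⁻ ξ, H (s, ξ)
        = ∫⁻ ξ, 2 * (ENNReal.ofReal (‖ξ‖ ^ (2 - 2*α)) * C (s, ξ)) := by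
          refine lintegral_congr_ae ?_
          filter_upwards [ae_ne_zero] with ξ hξ
          rw [show 2 - 2*α = (1 - 2*α) + 1 by ring,
            Real.rpow_add_one (norm_pos_iff.2 hξ).ne', ENNReal.ofReal_mul (by positivity)]
          simp only [H]
          ring
      _ = 2 * ∫⁻ ξ, ENNReal.ofReal (‖ξ‖ ^ (2 - 2*α)) * C (s, ξ) :=
          lintegral_const_mul' _ _ (by simp)
      _ ≤ 2 * (4 * (1 * ENNReal.ofReal (Xnorm 1 (Θ s)))) := by
          gcongr
          refine (lintegral_rpow_mul_conv_le (f := fun ξ => a (s, ξ)) (by linarith) hα2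
            (by fun_prop)).trans ?_
          rw [hM]
          gcongr
      _ = 8 * ENNReal.ofReal (Xnorm 1 (Θ s)) := by ring
  have hlin := tendsto_lintegral_exp_mul (α := α)
    (g := fun ξ => ENNReal.ofReal (‖ξ‖ ^ (1 - 2*α)) * ‖Θ0 ξ‖ₑ)
    (AEMeasurable.mul (by fun_prop) hΘ0.aemeasurable_enorm)
    (by rw [← hΘ0.ofReal_Xnorm]; exact ENNReal.ofReal_ne_top)
  have hsum := hlin.add (tendsto_lintegral_duhamel (α := α) hH hHfin)
  rw [add_zero] at hsum
  have hbound : ∀ᶠ t in atTop, ENNReal.ofReal (Xnorm (1 - 2*α) (Θ t)) ≤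
      (∫⁻ ξ, ENNReal.ofReal (Real.exp (-t * ‖ξ‖ ^ (2*α))) *
        (ENNReal.ofReal (‖ξ‖ ^ (1 - 2*α)) * ‖Θ0 ξ‖ₑ)) +
      ∫⁻ ξ, ∫⁻ s in Ioc 0 t,
        ENNReal.ofReal (Real.exp (-(t - s) * ‖ξ‖ ^ (2*α))) * H (s, ξ) := by
    filter_upwards [eventually_ge_atTop 0] with t ht
    have hm : AEMeasurable fun ξ : E2 => ENNReal.ofReal (Real.exp (-t * ‖ξ‖ ^ (2*α))) *
        (ENNReal.ofReal (‖ξ‖ ^ (1 - 2*α)) * ‖Θ0 ξ‖ₑ) :=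
      AEMeasurable.mul (by fun_prop) (AEMeasurable.mul (by fun_prop) hΘ0.aemeasurable_enorm)
    rw [(hmem t ht).ofReal_Xnorm, ← lintegral_add_left' hm]
    refine lintegral_mono_ae ?_
    filter_upwards [hDuhamel t ht] with ξ hξ
    have he : ∀ r : ℝ, ‖((Real.exp r : ℝ) : ℂ)‖ₑ = ENNReal.ofReal (Real.exp r) := fun r => by
      rw [← ofReal_norm, Complex.norm_real, Real.norm_of_nonneg (Real.exp_nonneg r)]
    have hB : ∀ᵐ s ∂(volume.restrict (Ioc 0 t)), ‖Bhat (Θ s) ξ‖ₑ ≤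
        2 * (ENNReal.ofReal ‖ξ‖ * C (s, ξ)) := by
      filter_upwards [ae_restrict_of_ae_restrict_of_subset Ioc_subset_Ioi_self ha] with s hs
      exact enorm_Bhat_le hs ξ
    rw [hξ, intervalIntegral.integral_of_le ht]
    calc _ ≤ ENNReal.ofReal (‖ξ‖ ^ (1 - 2*α)) *
          (ENNReal.ofReal (Real.exp (-t * ‖ξ‖ ^ (2*α))) * ‖Θ0 ξ‖ₑ +
            ∫⁻ s in Ioc 0 t, ENNReal.ofReal (Real.exp (-(t - s) * ‖ξ‖ ^ (2*α))) *
              (2 * (ENNReal.ofReal ‖ξ‖ * C (s, ξ)))) := by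
          gcongr
          refine enorm_sub_le.trans (add_le_add ?_ ?_)
          · rw [enorm_mul, he]
          · refine (enorm_integral_le_lintegral_enorm _).trans (lintegral_mono_ae ?_)
            filter_upwards [hB] with s hs
            rw [enorm_mul, he]
            gcongr
      _ = _ := by
          rw [mul_add, ← lintegral_const_mul' _ _ ENNReal.ofReal_ne_top]
          congr 1
          · ring
          · refine lintegral_congr fun s => ?_
            simp only [H]
            ring
  have hlim := tendsto_of_tendsto_of_tendsto_of_le_of_le' tendsto_const_nhds hsum
    (Eventually.of_forall fun _ => zero_le) hbound
  have := (ENNReal.tendsto_toReal ENNReal.zero_ne_top).comp hlim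
  refine this.congr fun t => ENNReal.toReal_ofReal (Xnorm_nonneg _ _)
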